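/- Let n be an even positive integer and k ≥ 1 an integer. Let cOpt, cOpt' : ZMod n → Bool be colorings with d_H(cOpt, cOpt') = 1 (OPT recolors a single node). Let cOff : ZMod n → Bool satisfy CE(cOff) ⊆ CE(cOpt) and |CE(cOff)| = min(2k, |CE(cOpt)|). Then there exists a coloring cOff' : ZMod n → Bool such that CE(cOff') ⊆ CE(cOpt'), |CE(cOff')| = min(2k, |CE(cOpt')|), and d_H(cOff, cOff') + φ(cOpt', cOff') ≤ 1 + φ(cOpt, cOff). -/

import Mathlib

/-- The cut-edge set of a coloring `c` of the ring `ZMod n`. -/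
def CE {n : ℕ} (c : ZMod n → Bool) : Set (ZMod n) := {i | c i ≠ c (i + 1)}

/-- Hamming distance between two colorings of `ZMod n`. -/
noncomputable def hamDist {n : ℕ} (c c' : ZMod n → Bool) : ℕ :=
  {i : ZMod n | c i ≠ c' i}.ncard

/-- The potential: distance from the coloring of OPT to the nearer of the two
colorings of OFF (up to a swap of color names). -/
noncomputable def pot (n : ℕ) (c c' : ZMod n → Bool) : ℕ :=
  min (hamDist c c') (n - hamDist c c')

theorem mem_CE_iff {n : ℕ} (c : ZMod n → Bool) (i : ZMod n) :
    i ∈ CE c ↔ c i ≠ c (i + 1) := Iff.rfl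

theorem CE_not {n : ℕ} (c : ZMod n → Bool) : CE (fun i => !c i) = CE c := by
  ext i
  simp [mem_CE_iff]

theorem CE_xor {n : ℕ} (c f : ZMod n → Bool) :
    CE (fun i => xor (c i) (f i)) = symmDiff (CE c) (CE f) := by
  ext i
  simp only [Set.mem_symmDiff, mem_CE_iff]
  cases c i <;> cases c (i + 1) <;> cases f i <;> cases f (i + 1) <;> simp

theorem even_ncard_CE {n : ℕ} [NeZero n] (c : ZMod n → Bool) : Even (CE c).ncard := by
  classical
  have hset : CE c = ↑(Finset.univ.filter fun i => c i ≠ c (i + 1)) := by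
    ext i
    simp [mem_CE_iff]
  rw [hset, Set.ncard_coe_finset, ← ZMod.natCast_eq_zero_iff_even, Finset.card_filter]
  push_cast
  let x : ZMod n → ZMod 2 := fun i => if c i then 1 else 0
  have hx : ∀ i, (if c i ≠ c (i + 1) then (1 : ZMod 2) else 0) = x i + x (i + 1) := by
    intro i
    simp only [x]
    cases c i <;> cases c (i + 1) <;> simp; decide
  have hshift : ∑ i, x (i + 1) = ∑ i, x i := Equiv.sum_comp (Equiv.addRight (1 : ZMod n)) x
  rw [Finset.sum_congr rfl fun i _ => hx i, Finset.sum_add_distrib, hshift]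
  exact CharTwo.add_self_eq_zero _

theorem hamDist_self {n : ℕ} (c : ZMod n → Bool) : hamDist c c = 0 := by
  simp [hamDist]

theorem hamDist_comm {n : ℕ} (a b : ZMod n → Bool) : hamDist a b = hamDist b a := by
  simp only [hamDist, ne_comm]

theorem hamDist_triangle {n : ℕ} [NeZero n] (a b c : ZMod n → Bool) :
    hamDist a c ≤ hamDist a b + hamDist b c := by
  refine (Set.ncard_le_ncard ?_ (Set.toFinite _)).trans (Set.ncard_union_le _ _)
  intro i hi
  simp only [Set.mem_union, Set.mem_ofPred_eq] at hi ⊢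
  by_contra! h
  exact hi (h.1.trans h.2)

theorem hamDist_not_add {n : ℕ} [NeZero n] (a b : ZMod n → Bool) :
    hamDist (fun i => !a i) b + hamDist a b = n := by
  have h : {i | (!a i) ≠ b i} = {i | a i ≠ b i}ᶜ := by
    ext i
    cases h1 : a i <;> cases h2 : b i <;> simp [h1, h2]
  rw [hamDist, hamDist, h, add_comm, Set.ncard_add_ncard_compl, Nat.card_zmod]

/-- The indicator of the arc `a + 1, …, a + m`. -/
def arc {n : ℕ} (a : ZMod n) (m : ℕ) (x : ZMod n) : Bool :=
  decide (1 ≤ (x - a).val ∧ (x - a).val ≤ m)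

theorem CE_arc {n : ℕ} [NeZero n] (a : ZMod n) {m : ℕ} (hm : 1 ≤ m) (hmn : m < n) :
    CE (arc a m) = {a, a + m} := by
  ext x
  obtain ⟨t, ht, rfl⟩ : ∃ t < n, x = a + (t : ZMod n) :=
    ⟨(x - a).val, ZMod.val_lt _, by simp⟩
  have h1 : (a + (t : ZMod n) - a).val = t := by
    rw [add_sub_cancel_left, ZMod.val_natCast_of_lt ht]
  have h2 : (a + (t : ZMod n) + 1 - a).val = if t + 1 < n then t + 1 else 0 := by
    rw [show a + (t : ZMod n) + 1 - a = ((t + 1 : ℕ) : ZMod n) by push_cast; ring]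
    split_ifs with h
    · exact ZMod.val_natCast_of_lt h
    · rw [show t + 1 = n by omega]
      simp
  have h3 : a + (t : ZMod n) = a ↔ t = 0 := by
    rw [add_eq_left, ZMod.natCast_eq_zero_iff]
    exact ⟨fun h => Nat.eq_zero_of_dvd_of_lt h ht, fun h => h ▸ dvd_zero n⟩
  have h4 : a + (t : ZMod n) = a + m ↔ t = m := by
    rw [add_right_inj, ZMod.natCast_eq_natCast_iff', Nat.mod_eq_of_lt ht, Nat.mod_eq_of_lt hmn]
  simp only [mem_CE_iff, Set.mem_insert_iff, Set.mem_singleton_iff, h3, h4, arc, h1, h2, ne_eq,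
    decide_eq_decide]
  split_ifs <;> omega

/-- Every cut edge of `D` bounds a maximal arc on which `D` is `true`. -/
theorem exists_arc {n : ℕ} [NeZero n] (D : ZMod n → Bool) {e : ZMod n} (he : e ∈ CE D) :
    ∃ (a : ZMod n) (m : ℕ), 1 ≤ m ∧ m < n ∧ (e = a ∨ e = a + m) ∧ D a = false ∧
      D (a + m + 1) = false ∧ ∀ j : ℕ, 1 ≤ j → j ≤ m → D (a + j) = true := by
  classical
  have hn : 0 < n := NeZero.pos n
  have hcast : ((n - 1 : ℕ) : ZMod n) = -1 := by
    rw [Nat.cast_sub hn]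
    simp
  rw [mem_CE_iff] at he
  cases h0 : D e with
  | false =>
    have h1 : D (e + 1) = true := by
      cases h : D (e + 1) <;> simp_all
    have hlast : D (e + (n - 1 : ℕ) + 1) = false := by
      rw [hcast]
      simpa using h0
    have hex : ∃ m : ℕ, D (e + m + 1) = false := ⟨n - 1, hlast⟩
    refine ⟨e, Nat.find hex, ?_, ?_, Or.inl rfl, h0, Nat.find_spec hex, ?_⟩
    · rw [Nat.one_le_iff_ne_zero]
      intro h
      have := Nat.find_spec hex
      rw [h] at this
      simp [h1] at this
    · have := Nat.find_min' hex hlast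
      omega
    · intro j hj hjm
      have := Nat.find_min hex (m := j - 1) (by omega)
      rw [Nat.cast_sub hj] at this
      simpa [add_assoc] using this
  | true =>
    have h1 : D (e + 1) = false := by
      cases h : D (e + 1) <;> simp_all
    have hlast : D (e - (n - 1 : ℕ)) = false := by
      rw [hcast]
      simpa using h1
    have hex : ∃ m : ℕ, D (e - m) = false := ⟨n - 1, hlast⟩
    refine ⟨e - (Nat.find hex : ℕ), Nat.find hex, ?_, ?_, Or.inr (by simp), Nat.find_spec hex,
      by simpa using h1, ?_⟩
    · rw [Nat.one_le_iff_ne_zero]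
      intro h
      have := Nat.find_spec hex
      rw [h] at this
      simp [h0] at this
    · have := Nat.find_min' hex hlast
      omega
    · intro j hj hjm
      have := Nat.find_min hex (m := Nat.find hex - j) (by omega)
      rw [Nat.cast_sub hjm] at this
      rw [show e - (Nat.find hex : ZMod n) + j = e - ((Nat.find hex : ZMod n) - j) by ring]
      simpa using this

/-- An edge cut by exactly one of `opt` and `off` can be toggled in `off`, together with one other
such edge, by moving `off` along a geodesic towards `opt`. -/
theorem exists_toggle {n : ℕ} [NeZero n] (opt off : ZMod n → Bool) {e : ZMod n}
    (he : e ∈ symmDiff (CE off) (CE opt)) :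
    ∃ (c : ZMod n → Bool) (e' : ZMod n), e' ∈ symmDiff (CE off) (CE opt) ∧
      CE c = symmDiff (CE off) {e, e'} ∧
      hamDist off c + hamDist opt c = hamDist opt off := by
  rw [← CE_xor] at he ⊢
  set D : ZMod n → Bool := fun i => xor (off i) (opt i) with hDdef
  obtain ⟨a, m, hm, hmn, hea, h0, h1, hD⟩ := exists_arc D he
  have ha : a ∈ CE D := by
    have := hD 1 le_rfl hm
    rw [Nat.cast_one] at this
    rw [mem_CE_iff, h0, this]
    simp
  have hb : a + m ∈ CE D := by
    rw [mem_CE_iff, h1, hD m hm le_rfl]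
    simp
  have hsub : ∀ x, arc a m x = true → D x = true := by
    intro x hx
    simp only [arc, decide_eq_true_eq] at hx
    have := hD _ hx.1 hx.2
    rwa [ZMod.natCast_zmod_val, add_sub_cancel] at this
  have hham : hamDist off (fun i => xor (off i) (arc a m i)) +
      hamDist opt (fun i => xor (off i) (arc a m i)) = hamDist opt off := by
    have e1 : {i | off i ≠ xor (off i) (arc a m i)} = {i | arc a m i = true} := by
      ext i
      cases h : off i <;> cases h' : arc a m i <;> simp [h, h']
    have e2 : {i | opt i ≠ xor (off i) (arc a m i)} =
        {i | opt i ≠ off i} \ {i | arc a m i = true} := by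
      ext i
      have := hsub i
      simp only [hDdef] at this
      cases h : off i <;> cases h' : arc a m i <;> cases h'' : opt i <;> simp_all
    rw [hamDist, hamDist, hamDist, e1, e2, add_comm]
    refine Set.ncard_sdiff_add_ncard_of_subset ?_ (Set.toFinite _)
    intro i hi
    have := hsub i hi
    simp only [hDdef] at this
    cases h : off i <;> cases h'' : opt i <;> simp_all
  rcases hea with rfl | rfl
  · exact ⟨_, e + m, hb, by rw [CE_xor, CE_arc _ hm hmn], hham⟩
  · exact ⟨_, a, ha, by rw [CE_xor, CE_arc _ hm hmn, Set.pair_comm], hham⟩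

theorem exists_geodesic_of_le {n : ℕ} [NeZero n] (k : ℕ) (opt off : ZMod n → Bool)
    (hoff : (CE off).ncard ≤ 2 * k) (hopt : 2 * k ≤ (CE opt).ncard) :
    ∃ c : ZMod n → Bool, CE c ⊆ CE opt ∧ (CE c).ncard = 2 * k ∧
      hamDist off c + hamDist opt c ≤ hamDist opt off := by
  by_cases hdone : CE off ⊆ CE opt ∧ (CE off).ncard = 2 * k
  · exact ⟨off, hdone.1, hdone.2, by simp [hamDist_self]⟩
  obtain ⟨e, he, hcard⟩ : ∃ e ∈ symmDiff (CE off) (CE opt), ∀ e',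
      (symmDiff (CE off) {e, e'}).ncard ≤ 2 * k := by
    by_cases hs : CE off ⊆ CE opt
    · have hlt : (CE off).ncard < 2 * k := lt_of_le_of_ne hoff fun h => hdone ⟨hs, h⟩
      obtain ⟨r, hr⟩ := even_ncard_CE off
      obtain ⟨e, heT, heS⟩ := Set.exists_mem_notMem_of_ncard_lt_ncard (hlt.trans_le hopt)
      refine ⟨e, Or.inr ⟨heT, heS⟩, fun e' => ?_⟩
      have h1 : (symmDiff (CE off) {e, e'}).ncard ≤ (CE off ∪ {e, e'}).ncard :=
        Set.ncard_le_ncard symmDiff_le_sup (Set.toFinite _)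
      have h2 := Set.ncard_union_le (CE off) {e, e'}
      have h3 := Set.ncard_insert_le e {e'}
      rw [Set.ncard_singleton] at h3
      omega
    · obtain ⟨e, heS, heT⟩ := Set.not_subset.mp hs
      refine ⟨e, Or.inl ⟨heS, heT⟩, fun e' => ?_⟩
      have h1 : (symmDiff (CE off) {e, e'}).ncard ≤ (insert e' (CE off \ {e})).ncard := by
        refine Set.ncard_le_ncard ?_ (Set.toFinite _)
        intro x hx
        simp only [Set.mem_symmDiff, Set.mem_insert_iff, Set.mem_singleton_iff,
          Set.mem_sdiff] at hx ⊢
        by_cases hxe : x = e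
        · subst hxe
          tauto
        · tauto
      have h2 := Set.ncard_insert_le e' (CE off \ {e})
      have h3 := Set.ncard_sdiff_singleton_add_one heS (Set.toFinite _)
      omega
  obtain ⟨c, e', he', hc, hd⟩ := exists_toggle opt off he
  have hdec : (symmDiff (CE c) (CE opt)).ncard < (symmDiff (CE off) (CE opt)).ncard := by
    refine Set.ncard_lt_ncard ?_ (Set.toFinite _)
    have hpair : {e, e'} ⊆ symmDiff (CE off) (CE opt) := Set.pair_subset he he'
    have heq : symmDiff (CE c) (CE opt) = symmDiff (CE off) (CE opt) \ {e, e'} := by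
      rw [hc, symmDiff_right_comm, symmDiff_of_ge hpair]
    rw [heq]
    exact ⟨Set.sdiff_subset, fun h => (h he).2 (Set.mem_insert _ _)⟩
  obtain ⟨c', hsub', hcard', hd'⟩ := exists_geodesic_of_le k opt c (hc ▸ hcard e') hopt
  refine ⟨c', hsub', hcard', ?_⟩
  have := hamDist_triangle off c c'
  omega
termination_by (symmDiff (CE off) (CE opt)).ncard

theorem exists_geodesic {n : ℕ} [NeZero n] (k : ℕ) (opt off : ZMod n → Bool)
    (hoff : (CE off).ncard ≤ 2 * k) :
    ∃ c : ZMod n → Bool, CE c ⊆ CE opt ∧ (CE c).ncard = min (2 * k) (CE opt).ncard ∧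
      hamDist off c + hamDist opt c ≤ hamDist opt off := by
  rcases le_total (2 * k) (CE opt).ncard with h | h
  · rw [min_eq_left h]
    exact exists_geodesic_of_le k opt off hoff h
  · exact ⟨opt, subset_rfl, (min_eq_right h).symm, by rw [hamDist_self, hamDist_comm off, add_zero]⟩

theorem off_response_step (n k : ℕ) (hn : 0 < n) (hne : Even n) (hk : 1 ≤ k)
    (cOpt cOpt' cOff : ZMod n → Bool)
    (hstep : hamDist cOpt cOpt' = 1)
    
    (hsub : CE cOff ⊆ CE cOpt)
    (hcard : (CE cOff).ncard = min (2 * k) (CE cOpt).ncard) :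
    ∃ cOff' : ZMod n → Bool,
      CE cOff' ⊆ CE cOpt' ∧
      (CE cOff').ncard = min (2 * k) (CE cOpt').ncard ∧
      hamDist cOff cOff' + pot n cOpt' cOff' ≤ 1 + pot n cOpt cOff := by
  have : NeZero n := ⟨hn.ne'⟩
  have hoff : (CE cOff).ncard ≤ 2 * k := hcard ▸ min_le_left _ _
  have h1 := hamDist_triangle cOpt' cOpt cOff
  have h2 := hamDist_triangle cOpt cOpt' cOff
  rw [hamDist_comm cOpt' cOpt] at h1
  have h3 := hamDist_not_add cOpt' cOff
  rcases le_total (hamDist cOpt cOff) (n - hamDist cOpt cOff) with h | h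
  · obtain ⟨c, hc, hcc, hd⟩ := exists_geodesic k cOpt' cOff hoff
    refine ⟨c, hc, hcc, ?_⟩
    simp only [pot]
    omega
  · obtain ⟨c, hc, hcc, hd⟩ := exists_geodesic k (fun i => !cOpt' i) cOff hoff
    rw [CE_not] at hc hcc
    refine ⟨c, hc, hcc, ?_⟩
    have h4 := hamDist_not_add cOpt' c
    simp only [pot]
    omega
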